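/- For every dataset D and every natural number ℓ ≥ 1, the greedy estimate is a 2-approximation of the bounded distinct count: (1/2)·D_ℓ(D) ≤ D̂_ℓ(D) ≤ D_ℓ(D). -/

import Mathlib

/-- The one-person greedy step: `g(u, S) = S ∪ {min (u \ S)}` if `u \ S ≠ ∅`,
and `g(u, S) = S` otherwise. -/
def gstep {Ω : Type*} [LinearOrder Ω] (u S : Finset Ω) : Finset Ω :=
  if h : (u \ S).Nonempty then insert ((u \ S).min' h) S else S

/-- One greedy pass over the dataset `D = (u_1, …, u_n)`:
`S ↦ g(u_n, g(u_{n−1}, …, g(u_1, S)…))`. -/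
def greedyPass {Ω : Type*} [LinearOrder Ω] (D : List (Finset Ω)) (S : Finset Ω) :
    Finset Ω :=
  D.foldl (fun T u => gstep u T) S

/-- The greedy estimate `D̂_ℓ(D)`: the cardinality of the set obtained by applying
the greedy pass over `D` exactly `ℓ` times, starting from the empty set. -/
def greedyEst {Ω : Type*} [LinearOrder Ω] (D : List (Finset Ω)) (ℓ : ℕ) : ℕ :=
  ((greedyPass D)^[ℓ] ∅).card

/-- The set of distinct elements of a dataset `D = (u_1, …, u_n)`. -/
def dsUnion {Ω : Type*} [DecidableEq Ω] (D : List (Finset Ω)) : Finset Ω :=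
  D.foldr (· ∪ ·) ∅

/-- The distinct count `DC(D) = |⋃ᵢ uᵢ|`. -/
def DC {Ω : Type*} [DecidableEq Ω] (D : List (Finset Ω)) : ℕ :=
  (dsUnion D).card

/-- The bounded distinct count
`D_ℓ(D) = max { |⋃ᵢ vᵢ| : vᵢ ⊆ uᵢ and |vᵢ| ≤ ℓ for all i }`. -/
noncomputable def boundedDC {Ω : Type*} [DecidableEq Ω] (D : List (Finset Ω)) (ℓ : ℕ) : ℕ :=
  sSup { k : ℕ | ∃ v : List (Finset Ω),
    List.Forall₂ (fun a b => a ⊆ b ∧ a.card ≤ ℓ) v D ∧ k = DC v }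

section Greedy

variable {Ω : Type*} [LinearOrder Ω]

theorem subset_gstep (u S : Finset Ω) : S ⊆ gstep u S := by
  unfold gstep
  split_ifs
  · exact Finset.subset_insert _ _
  · exact Finset.Subset.refl S

theorem card_gstep_of_not_subset {u S : Finset Ω} (h : ¬ u ⊆ S) :
    (gstep u S).card = S.card + 1 := by
  have hne : (u \ S).Nonempty := Finset.sdiff_nonempty.mpr h
  unfold gstep
  rw [dif_pos hne, Finset.card_insert_of_notMem]
  exact (Finset.mem_sdiff.mp ((u \ S).min'_mem hne)).2

theorem exists_gstep_eq_union (u S : Finset Ω) :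
    ∃ a : Finset Ω, a ⊆ u ∧ a.card ≤ 1 ∧ gstep u S = S ∪ a := by
  unfold gstep
  split_ifs with h
  · refine ⟨{(u \ S).min' h}, ?_, by simp, ?_⟩
    · exact Finset.singleton_subset_iff.mpr (Finset.mem_sdiff.mp ((u \ S).min'_mem h)).1
    · rw [Finset.insert_eq, Finset.union_comm]
  · exact ⟨∅, by simp⟩

theorem greedyPass_cons (u : Finset Ω) (D : List (Finset Ω)) (S : Finset Ω) :
    greedyPass (u :: D) S = greedyPass D (gstep u S) := rfl

theorem dsUnion_cons (u : Finset Ω) (D : List (Finset Ω)) :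
    dsUnion (u :: D) = u ∪ dsUnion D := rfl

theorem subset_greedyPass (D : List (Finset Ω)) (S : Finset Ω) : S ⊆ greedyPass D S := by
  induction D generalizing S with
  | nil => exact Finset.Subset.refl S
  | cons u D ih => exact (subset_gstep u S).trans (ih _)

/-- One pass adds to `S` at most one element of each person's set. -/
theorem exists_greedyPass_eq_union (D : List (Finset Ω)) (S : Finset Ω) :
    ∃ w : List (Finset Ω), List.Forall₂ (fun a b => a ⊆ b ∧ a.card ≤ 1) w D ∧
      greedyPass D S = S ∪ dsUnion w := by
  induction D generalizing S with
  | nil => exact ⟨[], .nil, (Finset.union_empty S).symm⟩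
  | cons u D ih =>
    obtain ⟨a, hau, hac, ha⟩ := exists_gstep_eq_union u S
    obtain ⟨w, hw, hwS⟩ := ih (gstep u S)
    refine ⟨a :: w, .cons ⟨hau, hac⟩ hw, ?_⟩
    rw [greedyPass_cons, hwS, ha, dsUnion_cons, Finset.union_assoc]

/-- Contributions bounded by `k` and by `m` can be merged into contributions bounded by
`k + m`. -/
theorem exists_forall₂_dsUnion_union {k m : ℕ} {v w D : List (Finset Ω)}
    (hv : List.Forall₂ (fun a b => a ⊆ b ∧ a.card ≤ k) v D)
    (hw : List.Forall₂ (fun a b => a ⊆ b ∧ a.card ≤ m) w D) :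
    ∃ x : List (Finset Ω), List.Forall₂ (fun a b => a ⊆ b ∧ a.card ≤ k + m) x D ∧
      dsUnion x = dsUnion v ∪ dsUnion w := by
  induction hv generalizing w with
  | nil =>
    cases hw
    exact ⟨[], .nil, (Finset.union_empty _).symm⟩
  | @cons a u v D ha _ ih =>
    cases hw with
    | @cons b _ w _ hb hw =>
      obtain ⟨x, hx, hxe⟩ := ih hw
      refine ⟨(a ∪ b) :: x, .cons ⟨Finset.union_subset ha.1 hb.1, ?_⟩ hx, ?_⟩
      · exact (Finset.card_union_le a b).trans (Nat.add_le_add ha.2 hb.2)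
      · rw [dsUnion_cons, dsUnion_cons, dsUnion_cons, hxe, Finset.union_union_union_comm]

/-- The greedy set is the union of feasible contributions. -/
theorem exists_dsUnion_eq_greedyPass_iterate (D : List (Finset Ω)) (ℓ : ℕ) :
    ∃ w : List (Finset Ω), List.Forall₂ (fun a b => a ⊆ b ∧ a.card ≤ ℓ) w D ∧
      dsUnion w = (greedyPass D)^[ℓ] ∅ := by
  induction ℓ with
  | zero =>
    rw [Function.iterate_zero_apply]
    induction D with
    | nil => exact ⟨[], .nil, rfl⟩
    | cons u D ih =>
      obtain ⟨w, hw, hwe⟩ := ih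
      exact ⟨∅ :: w, .cons ⟨Finset.empty_subset u, by simp⟩ hw, by simp [dsUnion_cons, hwe]⟩
  | succ ℓ ih =>
    obtain ⟨v, hv, hve⟩ := ih
    obtain ⟨w, hw, hwe⟩ := exists_greedyPass_eq_union D ((greedyPass D)^[ℓ] ∅)
    obtain ⟨x, hx, hxe⟩ := exists_forall₂_dsUnion_union hv hw
    exact ⟨x, hx, by rw [Function.iterate_succ_apply', hwe, hxe, hve]⟩

/-- A pass ending inside `F` gains an element for every person whose set is not covered
by `F`. -/
theorem card_add_countP_le_card_greedyPass (F : Finset Ω) (D : List (Finset Ω))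
    (S : Finset Ω) (hF : greedyPass D S ⊆ F) :
    S.card + D.countP (fun u => ¬ u ⊆ F) ≤ (greedyPass D S).card := by
  induction D generalizing S with
  | nil => simp [greedyPass]
  | cons u D ih =>
    rw [greedyPass_cons] at hF ⊢
    have h := ih _ hF
    by_cases hu : u ⊆ F
    · have hle := Finset.card_le_card (subset_gstep u S)
      rw [List.countP_cons_of_neg (by simpa using hu)]
      lia
    · have hS : ¬ u ⊆ S := fun huS =>
        hu (huS.trans ((subset_gstep u S).trans ((subset_greedyPass D _).trans hF)))
      rw [List.countP_cons_of_pos (by simpa using hu)]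
      rw [card_gstep_of_not_subset hS] at h
      lia

theorem mul_countP_le_card_greedyPass_iterate (F : Finset Ω) (D : List (Finset Ω)) (ℓ : ℕ)
    (hF : (greedyPass D)^[ℓ] ∅ ⊆ F) :
    ℓ * D.countP (fun u => ¬ u ⊆ F) ≤ ((greedyPass D)^[ℓ] ∅).card := by
  induction ℓ with
  | zero => simp
  | succ ℓ ih =>
    rw [Function.iterate_succ_apply'] at hF ⊢
    have h := card_add_countP_le_card_greedyPass F D _ hF
    have h' := ih ((subset_greedyPass D _).trans hF)
    rw [Nat.succ_mul]
    lia

/-- Outside `F`, only the persons whose sets are not covered by `F` contribute. -/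
theorem card_dsUnion_sdiff_le (F : Finset Ω) {ℓ : ℕ} {v D : List (Finset Ω)}
    (hv : List.Forall₂ (fun a b => a ⊆ b ∧ a.card ≤ ℓ) v D) :
    (dsUnion v \ F).card ≤ ℓ * D.countP (fun u => ¬ u ⊆ F) := by
  induction hv with
  | nil => simp [dsUnion]
  | @cons a u v D ha _ ih =>
    rw [dsUnion_cons, Finset.union_sdiff_distrib]
    refine (Finset.card_union_le _ _).trans ?_
    by_cases hu : u ⊆ F
    · rw [List.countP_cons_of_neg (by simpa using hu),
        Finset.sdiff_eq_empty_iff_subset.mpr (ha.1.trans hu), Finset.card_empty, Nat.zero_add]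
      exact ih
    · rw [List.countP_cons_of_pos (by simpa using hu), Nat.mul_succ]
      have h := Finset.card_le_card (Finset.sdiff_subset (s := a) (t := F))
      have h' := ha.2
      lia

theorem DC_le_two_mul_greedyEst {ℓ : ℕ} {v D : List (Finset Ω)}
    (hv : List.Forall₂ (fun a b => a ⊆ b ∧ a.card ≤ ℓ) v D) :
    DC v ≤ 2 * greedyEst D ℓ := by
  unfold DC greedyEst
  have h₁ := card_dsUnion_sdiff_le ((greedyPass D)^[ℓ] ∅) hv
  have h₂ := mul_countP_le_card_greedyPass_iterate _ D ℓ (Finset.Subset.refl _)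
  have h₃ := Finset.card_le_card_sdiff_add_card (s := dsUnion v) (t := (greedyPass D)^[ℓ] ∅)
  lia

end Greedy

/-- The greedy estimate is a 2-approximation of the bounded distinct count:
`(1/2)·D_ℓ(D) ≤ D̂_ℓ(D) ≤ D_ℓ(D)`. -/
theorem greedyEst_two_approx {Ω : Type*} [LinearOrder Ω]
    (D : List (Finset Ω)) (ℓ : ℕ) (hℓ : 1 ≤ ℓ) :
    (boundedDC D ℓ : ℝ) / 2 ≤ (greedyEst D ℓ : ℝ) ∧ greedyEst D ℓ ≤ boundedDC D ℓ := by
  have hub : 2 * greedyEst D ℓ ∈ upperBounds { k : ℕ | ∃ v : List (Finset Ω),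
      List.Forall₂ (fun a b => a ⊆ b ∧ a.card ≤ ℓ) v D ∧ k = DC v } := by
    rintro k ⟨v, hv, rfl⟩
    exact DC_le_two_mul_greedyEst hv
  constructor
  · have h : boundedDC D ℓ ≤ 2 * greedyEst D ℓ := csSup_le' hub
    have h' : (boundedDC D ℓ : ℝ) ≤ 2 * greedyEst D ℓ := by exact_mod_cast h
    linarith
  · obtain ⟨w, hw, hwe⟩ := exists_dsUnion_eq_greedyPass_iterate D ℓ
    exact le_csSup ⟨_, hub⟩ ⟨w, hw, by rw [DC, hwe, greedyEst]⟩
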